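/- (Corollary: zero curvature is equivalent to a constant, hence unique, equilibrium price.) The following are equivalent: (i) for every index i with 1 ≤ i ≤ L−1 and every (t,α) ∈ ℝ × ℝ^{L−1}, Σ_{s=0}^{L−1} R^s_{0i0}(t,α) g_{si}(t,α) = 0; (ii) for every t ∈ ℝ and every i with 1 ≤ i ≤ L−1, p_i'(t) = 0; (iii) each function p_i is constant on ℝ. -/

import Mathlib

/-!
Formalization of results from "A geometric approach to equilibrium selection":
the metric, Christoffel symbols and curvature of the equilibrium manifold of a
two-consumer exchange economy with `L` goods, parametrized by
`Φ(t,α) = (p_1(t),…,p_{L−1}(t), α_1,…,α_{L−1}, w(t) − Σ_m p_m(t) α_m)`.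

Indices run over `Fin L`, where the index `0` corresponds to the coordinate
`x_0 = t` and an index `i ≠ 0` corresponds to the coordinate `x_i = α_i`
(the component `α 0` of `α : Fin L → ℝ` is never used, so `α` is just a copy
of `ℝ^{L−1}` together with an irrelevant extra coordinate).
-/

open Matrix BigOperators

noncomputable section

namespace EqSelection

variable {L : ℕ}

/-- `A(t,α) = w'(t) − Σ_{m=1}^{L−1} p_m'(t) α_m`. -/
def eqA [NeZero L] (p : Fin L → ℝ → ℝ) (w : ℝ → ℝ) (t : ℝ) (α : Fin L → ℝ) : ℝ :=
  deriv w t - ∑ m ∈ Finset.univ \ {0}, deriv (p m) t * α m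

/-- `A'(t,α) = w''(t) − Σ_{m=1}^{L−1} p_m''(t) α_m`. -/
def eqA' [NeZero L] (p : Fin L → ℝ → ℝ) (w : ℝ → ℝ) (t : ℝ) (α : Fin L → ℝ) : ℝ :=
  deriv (deriv w) t - ∑ m ∈ Finset.univ \ {0}, deriv (deriv (p m)) t * α m

/-- `B(t) = Σ_{m=1}^{L−1} (p_m'(t))²`. -/
def eqB [NeZero L] (p : Fin L → ℝ → ℝ) (t : ℝ) : ℝ :=
  ∑ m ∈ Finset.univ \ {0}, (deriv (p m) t) ^ 2

/-- `N(t) = 1 + Σ_{m=1}^{L−1} (p_m(t))²`. -/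
def eqN [NeZero L] (p : Fin L → ℝ → ℝ) (t : ℝ) : ℝ :=
  1 + ∑ m ∈ Finset.univ \ {0}, (p m t) ^ 2

/-- `C(t) = Σ_{m=1}^{L−1} p_m'(t) p_m''(t)`. -/
def eqC [NeZero L] (p : Fin L → ℝ → ℝ) (t : ℝ) : ℝ :=
  ∑ m ∈ Finset.univ \ {0}, deriv (p m) t * deriv (deriv (p m)) t

/-- `P(t) = Σ_{m=1}^{L−1} p_m(t) p_m'(t)`. -/
def eqP [NeZero L] (p : Fin L → ℝ → ℝ) (t : ℝ) : ℝ :=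
  ∑ m ∈ Finset.univ \ {0}, p m t * deriv (p m) t

/-- The induced metric matrix `g(t,α)`: `g_{00} = B + A²`, `g_{0i} = g_{i0} = −p_i A`,
`g_{ij} = p_i p_j + δ_{ij}` for `i, j ≠ 0`. -/
def gMat [NeZero L] (p : Fin L → ℝ → ℝ) (w : ℝ → ℝ) (t : ℝ) (α : Fin L → ℝ) :
    Matrix (Fin L) (Fin L) ℝ :=
  Matrix.of fun i j =>
    if i = 0 then
      if j = 0 then eqB p t + (eqA p w t α) ^ 2 else -(p j t) * eqA p w t α
    else
      if j = 0 then -(p i t) * eqA p w t α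
      else p i t * p j t + (if i = j then 1 else 0)

/-- Partial derivative with respect to the coordinate `x_k`, where `x_0 = t`
and `x_i = α_i` for `i ≠ 0`. -/
def pder [NeZero L] (k : Fin L) (f : ℝ → (Fin L → ℝ) → ℝ) (t : ℝ) (α : Fin L → ℝ) : ℝ :=
  if k = 0 then deriv (fun s => f s α) t
  else deriv (fun s => f t (Function.update α k s)) (α k)

/-- Christoffel symbol
`Γ^k_{ij} = (1/2) Σ_{h=0}^{L−1} g^{hk} (∂g_{jh}/∂x_i + ∂g_{hi}/∂x_j − ∂g_{ij}/∂x_h)`,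
written `christoffel p w i j k`.  (Here `g^{hk}` denotes the entries of the inverse
matrix of `g`, i.e. of `(gMat p w t α)⁻¹`.) -/
def christoffel [NeZero L] (p : Fin L → ℝ → ℝ) (w : ℝ → ℝ) (i j k : Fin L)
    (t : ℝ) (α : Fin L → ℝ) : ℝ :=
  (1 / 2) * ∑ h : Fin L,
    (gMat p w t α)⁻¹ h k *
      (pder i (fun t' α' => gMat p w t' α' j h) t α
        + pder j (fun t' α' => gMat p w t' α' h i) t α
        - pder h (fun t' α' => gMat p w t' α' i j) t α)

/-- Curvature coefficient
`R^s_{ijk} = Σ_{m} Γ^m_{ik} Γ^s_{jm} − Σ_{m} Γ^m_{jk} Γ^s_{im} + ∂Γ^s_{ik}/∂x_j − ∂Γ^s_{jk}/∂x_i`,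
written `curvR p w i j k s`. -/
def curvR [NeZero L] (p : Fin L → ℝ → ℝ) (w : ℝ → ℝ) (i j k s : Fin L)
    (t : ℝ) (α : Fin L → ℝ) : ℝ :=
  (∑ m : Fin L, christoffel p w i k m t α * christoffel p w j m s t α)
    - (∑ m : Fin L, christoffel p w j k m t α * christoffel p w i m s t α)
    + pder j (christoffel p w i k s) t α - pder i (christoffel p w j k s) t α

/-- The coordinate tangent vectors `Φ_i(t,α) ∈ ℝ^{2L−1}` of the parametrization
`Φ(t,α) = (p_1(t),…,p_{L−1}(t), α_1,…,α_{L−1}, w(t) − Σ_m p_m(t) α_m)`: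
`Φ_0 = (p_1',…,p_{L−1}', 0,…,0, A)`, and for `i ≠ 0` the vector `Φ_i` has entry `1`
in position `(L−1)+i` (1-indexed), entry `−p_i` in the last position and `0` elsewhere. -/
def PhiVec [NeZero L] (p : Fin L → ℝ → ℝ) (w : ℝ → ℝ) (i : Fin L)
    (t : ℝ) (α : Fin L → ℝ) : Fin (2 * L - 1) → ℝ :=
  fun j =>
    if i = 0 then
      if h : (j : ℕ) < L - 1 then deriv (p ⟨(j : ℕ) + 1, by omega⟩) t
      else if (j : ℕ) = 2 * L - 2 then eqA p w t α else 0
    else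
      if (j : ℕ) + 1 = (L - 1) + (i : ℕ) then 1
      else if (j : ℕ) = 2 * L - 2 then -(p i t) else 0

/-- The matrix `M(t,α)` of Statement 2: `M_{00} = N`, `M_{0i} = M_{i0} = p_i A`,
`M_{ii} = (N − p_i²) B + A²`, `M_{ij} = −p_i p_j B` for `i ≠ j`, `i, j ≠ 0`. -/
def invNumer [NeZero L] (p : Fin L → ℝ → ℝ) (w : ℝ → ℝ) (t : ℝ) (α : Fin L → ℝ) :
    Matrix (Fin L) (Fin L) ℝ :=
  Matrix.of fun i j =>
    if i = 0 then
      if j = 0 then eqN p t else p j t * eqA p w t α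
    else
      if j = 0 then p i t * eqA p w t α
      else if i = j then (eqN p t - (p i t) ^ 2) * eqB p t + (eqA p w t α) ^ 2
      else -(p i t * p j t * eqB p t)

theorem deriv_sum_mul {ι : Type*} [Fintype ι] {F G : ι → ℝ → ℝ} {x : ℝ}
    (hF : ∀ s, DifferentiableAt ℝ (F s) x) (hG : ∀ s, DifferentiableAt ℝ (G s) x) :
    deriv (fun y => ∑ s, F s y * G s y) x
      = ∑ s, deriv (F s) x * G s x + ∑ s, F s x * deriv (G s) x := by
  rw [← Finset.sum_add_distrib]
  exact (HasDerivAt.fun_sum fun s _ => (hF s).hasDerivAt.mul (hG s).hasDerivAt).deriv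

theorem hasDerivAt_of_smooth {f : ℝ → ℝ} (hf : ContDiff ℝ (⊤ : ℕ∞) f) (t : ℝ) :
    HasDerivAt f (deriv f t) t :=
  (hf.differentiable (by simp) t).hasDerivAt

theorem hasDerivAt_deriv_of_smooth {f : ℝ → ℝ} (hf : ContDiff ℝ (⊤ : ℕ∞) f) (t : ℝ) :
    HasDerivAt (deriv f) (deriv (deriv f) t) t :=
  ((contDiff_infty.1 hf 2).differentiable_deriv_two t).hasDerivAt

section Curvature

variable [NeZero L] {p : Fin L → ℝ → ℝ} {w : ℝ → ℝ}

theorem sum_eq_zero_add_sum_ne (f : Fin L → ℝ) :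
    ∑ h, f h = f 0 + ∑ h ∈ Finset.univ \ {0}, f h := by
  rw [← Finset.sum_sdiff (Finset.subset_univ {(0 : Fin L)}), Finset.sum_singleton, add_comm]

theorem sum_ne_congr {f g : Fin L → ℝ} (h : ∀ i, i ≠ 0 → f i = g i) :
    ∑ i ∈ Finset.univ \ {0}, f i = ∑ i ∈ Finset.univ \ {0}, g i :=
  Finset.sum_congr rfl fun i hi => h i (by simpa using hi)

theorem eqA_update (k : Fin L) (hk : k ≠ 0) (t s : ℝ) (α : Fin L → ℝ) :
    eqA p w t (Function.update α k s) = eqA p w t α - deriv (p k) t * (s - α k) := by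
  have h : ∀ m, deriv (p m) t * Function.update α k s m
      = deriv (p m) t * α m + if m = k then deriv (p k) t * (s - α k) else 0 := by
    intro m
    by_cases hm : m = k
    · subst hm; simp; ring
    · simp [hm]
  simp only [eqA, h, Finset.sum_add_distrib]
  simp [hk]
  ring

theorem hasDerivAt_eqA_update (k : Fin L) (hk : k ≠ 0) (t : ℝ) (α : Fin L → ℝ) :
    HasDerivAt (fun s => eqA p w t (Function.update α k s)) (-deriv (p k) t) (α k) := by
  simp only [eqA_update k hk]
  exact ((((hasDerivAt_id' (α k)).sub_const (α k)).const_mul (deriv (p k) t)).const_sub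
    (eqA p w t α)).congr_deriv (by ring)

theorem hasDerivAt_eqA'_update (k : Fin L) (hk : k ≠ 0) (t : ℝ) (α : Fin L → ℝ) :
    HasDerivAt (fun s => eqA' p w t (Function.update α k s)) (-deriv (deriv (p k)) t) (α k) :=
  hasDerivAt_eqA_update (p := fun m => deriv (p m)) (w := deriv w) k hk t α

theorem hasDerivAt_eqA (hp : ∀ i, ContDiff ℝ (⊤ : ℕ∞) (p i)) (hw : ContDiff ℝ (⊤ : ℕ∞) w)
    (t : ℝ) (α : Fin L → ℝ) : HasDerivAt (fun s => eqA p w s α) (eqA' p w t α) t :=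
  (hasDerivAt_deriv_of_smooth hw t).sub
    (HasDerivAt.fun_sum fun m _ => (hasDerivAt_deriv_of_smooth (hp m) t).mul_const (α m))

theorem hasDerivAt_eqB (hp : ∀ i, ContDiff ℝ (⊤ : ℕ∞) (p i)) (t : ℝ) :
    HasDerivAt (eqB p) (2 * eqC p t) t := by
  rw [eqC, Finset.mul_sum]
  refine HasDerivAt.fun_sum fun m _ => ?_
  exact ((hasDerivAt_deriv_of_smooth (hp m) t).fun_pow 2).congr_deriv (by simp; ring)

theorem differentiableAt_eqN (hp : ∀ i, ContDiff ℝ (⊤ : ℕ∞) (p i)) (t : ℝ) :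
    DifferentiableAt ℝ (eqN p) t :=
  (DifferentiableAt.fun_sum fun m _ =>
    (hasDerivAt_of_smooth (hp m) t).differentiableAt.pow 2).const_add 1

/-- The determinant of the metric. -/
def eqD (p : Fin L → ℝ → ℝ) (w : ℝ → ℝ) (t : ℝ) (α : Fin L → ℝ) : ℝ :=
  eqN p t * eqB p t + eqA p w t α ^ 2

theorem eqB_nonneg (t : ℝ) : 0 ≤ eqB p t := Finset.sum_nonneg fun _ _ => sq_nonneg _

theorem eqN_pos (t : ℝ) : 0 < eqN p t :=
  add_pos_of_pos_of_nonneg one_pos (Finset.sum_nonneg fun _ _ => sq_nonneg _)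

theorem deriv_eq_zero_of_eqB_eq_zero {t : ℝ} (h : eqB p t = 0) {i : Fin L} (hi : i ≠ 0) :
    deriv (p i) t = 0 := by
  have := (Finset.sum_eq_zero_iff_of_nonneg fun m _ => sq_nonneg (deriv (p m) t)).1 h i
    (by simpa using hi)
  simpa using this

theorem eqD_pos (hreg : ∀ t : ℝ, 0 < eqB p t ∨ deriv w t ≠ 0) (t : ℝ) (α : Fin L → ℝ) :
    0 < eqD p w t α := by
  have hN := eqN_pos (p := p) t
  rcases (eqB_nonneg (p := p) t).eq_or_lt with hB | hB
  · have hA : eqA p w t α = deriv w t := by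
      rw [eqA, Finset.sum_eq_zero, sub_zero]
      intro m hm
      rw [deriv_eq_zero_of_eqB_eq_zero hB.symm (by simpa using hm), zero_mul]
    have hw : deriv w t ≠ 0 := (hreg t).resolve_left (by simp [← hB])
    rw [eqD, ← hB, hA]
    positivity
  · rw [eqD]; positivity

section Metric

variable (t : ℝ) (α : Fin L → ℝ)

theorem gMat_zero_zero : gMat p w t α 0 0 = eqB p t + eqA p w t α ^ 2 := by simp [gMat]

theorem gMat_zero_ne {j : Fin L} (hj : j ≠ 0) : gMat p w t α 0 j = -(p j t) * eqA p w t α := by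
  simp [gMat, hj]

theorem gMat_ne_zero {i : Fin L} (hi : i ≠ 0) : gMat p w t α i 0 = -(p i t) * eqA p w t α := by
  simp [gMat, hi]

theorem gMat_ne_ne {i j : Fin L} (hi : i ≠ 0) (hj : j ≠ 0) :
    gMat p w t α i j = p i t * p j t + if i = j then 1 else 0 := by
  simp [gMat, hi, hj]

theorem gMat_comm (i j : Fin L) : gMat p w t α i j = gMat p w t α j i := by
  by_cases hi : i = 0 <;> by_cases hj : j = 0 <;> simp [gMat, hi, hj, mul_comm, eq_comm]

theorem invNumer_zero_zero : invNumer p w t α 0 0 = eqN p t := by simp [invNumer]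

theorem invNumer_zero_ne {j : Fin L} (hj : j ≠ 0) :
    invNumer p w t α 0 j = p j t * eqA p w t α := by
  simp [invNumer, hj]

theorem invNumer_ne_zero {i : Fin L} (hi : i ≠ 0) :
    invNumer p w t α i 0 = p i t * eqA p w t α := by
  simp [invNumer, hi]

theorem invNumer_ne_ne {i j : Fin L} (hi : i ≠ 0) (hj : j ≠ 0) :
    invNumer p w t α i j = (if i = j then eqD p w t α else 0) - p i t * p j t * eqB p t := by
  by_cases h : i = j
  · subst h; simp [invNumer, hi, eqD]; ring
  · simp [invNumer, hi, hj, h]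

theorem sum_sq_eq_eqN_sub_one : ∑ m ∈ Finset.univ \ {0}, p m t * p m t = eqN p t - 1 := by
  simp [eqN, pow_two]

theorem gMat_mul_invNumer : gMat p w t α * invNumer p w t α = eqD p w t α • 1 := by
  have hS := sum_sq_eq_eqN_sub_one (p := p) t
  ext i j
  rw [Matrix.mul_apply, sum_eq_zero_add_sum_ne]
  by_cases hi : i = 0 <;> by_cases hj : j = 0
  · subst hi hj
    rw [sum_ne_congr (g := fun h => (-eqA p w t α ^ 2) * (p h t * p h t)) fun h hh => by
      rw [gMat_zero_ne t α hh, invNumer_ne_zero t α hh]; ring]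
    rw [← Finset.mul_sum, hS, gMat_zero_zero, invNumer_zero_zero]
    simp [eqD]; ring
  · subst hi
    rw [sum_ne_congr (g := fun h => (p j t * eqB p t * eqA p w t α) * (p h t * p h t)
        - if h = j then p j t * eqA p w t α * eqD p w t α else 0) fun h hh => by
      rw [gMat_zero_ne t α hh, invNumer_ne_ne t α hh hj]
      by_cases e : h = j
      · subst e; simp; ring
      · simp [e]; ring]
    rw [Finset.sum_sub_distrib, ← Finset.mul_sum, hS, gMat_zero_zero, invNumer_zero_ne t α hj]
    simp [hj, Ne.symm hj, eqD]; ring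
  · subst hj
    rw [sum_ne_congr (g := fun h => (p i t * eqA p w t α) * (p h t * p h t)
        + if h = i then p i t * eqA p w t α else 0) fun h hh => by
      rw [gMat_ne_ne t α hi hh, invNumer_ne_zero t α hh]
      by_cases e : h = i
      · subst e; simp; ring
      · simp [e, Ne.symm e]; ring]
    rw [Finset.sum_add_distrib, ← Finset.mul_sum, hS, gMat_ne_zero t α hi, invNumer_zero_zero]
    simp [hi]; ring
  · rw [sum_ne_congr (g := fun h => (-(p i t * p j t * eqB p t)) * (p h t * p h t)
        + (if h = j then p i t * p j t * eqD p w t α else 0)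
        + (if h = i then (if i = j then eqD p w t α else 0) - p i t * p j t * eqB p t else 0))
        fun h hh => by
      rw [gMat_ne_ne t α hi hh, invNumer_ne_ne t α hh hj]
      by_cases e : h = i
      · subst e
        by_cases e' : h = j
        · subst e'; simp; ring
        · simp [e']; ring
      · by_cases e' : h = j
        · subst e'; simp [e, Ne.symm e]; ring
        · simp [e, e', Ne.symm e]; ring]
    rw [Finset.sum_add_distrib, Finset.sum_add_distrib, ← Finset.mul_sum, hS,
      gMat_ne_zero t α hi, invNumer_zero_ne t α hj]
    simp [hi, hj, Matrix.one_apply, eqD]; ring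

variable {t α}

theorem isUnit_det_gMat (hD : eqD p w t α ≠ 0) : IsUnit (gMat p w t α).det := by
  refine Matrix.isUnit_det_of_right_inverse (B := (eqD p w t α)⁻¹ • invNumer p w t α) ?_
  rw [Matrix.mul_smul, gMat_mul_invNumer, smul_smul, inv_mul_cancel₀ hD, one_smul]

theorem inv_gMat (hD : eqD p w t α ≠ 0) :
    (gMat p w t α)⁻¹ = (eqD p w t α)⁻¹ • invNumer p w t α := by
  refine Matrix.inv_eq_right_inv ?_
  rw [Matrix.mul_smul, gMat_mul_invNumer, smul_smul, inv_mul_cancel₀ hD, one_smul]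

end Metric

section PartialDerivatives

variable (t : ℝ) (α : Fin L → ℝ)

theorem pder_zero (f : ℝ → (Fin L → ℝ) → ℝ) :
    pder 0 f t α = deriv (fun s => f s α) t := by
  simp [pder]

theorem pder_ne {k : Fin L} (hk : k ≠ 0) (f : ℝ → (Fin L → ℝ) → ℝ) :
    pder k f t α = deriv (fun s => f t (Function.update α k s)) (α k) := by
  simp [pder, hk]

theorem hasDerivAt_gMat_zero_zero (hp : ∀ i, ContDiff ℝ (⊤ : ℕ∞) (p i))
    (hw : ContDiff ℝ (⊤ : ℕ∞) w) :
    HasDerivAt (fun s => gMat p w s α 0 0)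
      (2 * eqC p t + 2 * eqA p w t α * eqA' p w t α) t := by
  simp only [gMat_zero_zero]
  exact ((hasDerivAt_eqB hp t).fun_add ((hasDerivAt_eqA hp hw t α).fun_pow 2)).congr_deriv
    (by simp)

theorem hasDerivAt_gMat_ne_zero (hp : ∀ i, ContDiff ℝ (⊤ : ℕ∞) (p i))
    (hw : ContDiff ℝ (⊤ : ℕ∞) w) {i : Fin L} (hi : i ≠ 0) :
    HasDerivAt (fun s => gMat p w s α i 0)
      (-(deriv (p i) t) * eqA p w t α + -(p i t) * eqA' p w t α) t := by
  simp only [gMat_ne_zero _ _ hi]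
  exact (hasDerivAt_of_smooth (hp i) t).neg.mul (hasDerivAt_eqA hp hw t α)

theorem hasDerivAt_gMat_ne_ne (hp : ∀ i, ContDiff ℝ (⊤ : ℕ∞) (p i))
    {i j : Fin L} (hi : i ≠ 0) (hj : j ≠ 0) :
    HasDerivAt (fun s => gMat p w s α i j)
      (deriv (p i) t * p j t + p i t * deriv (p j) t) t := by
  simp only [gMat_ne_ne _ _ hi hj]
  exact ((hasDerivAt_of_smooth (hp i) t).mul (hasDerivAt_of_smooth (hp j) t)).add_const _

theorem hasDerivAt_gMat_update_zero_zero {k : Fin L} (hk : k ≠ 0) :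
    HasDerivAt (fun s => gMat p w t (Function.update α k s) 0 0)
      (-(2 * deriv (p k) t * eqA p w t α)) (α k) := by
  simp only [gMat_zero_zero]
  exact (((hasDerivAt_eqA_update k hk t α).fun_pow 2).const_add (eqB p t)).congr_deriv
    (by simp; ring)

theorem hasDerivAt_gMat_update_ne_zero {k i : Fin L} (hk : k ≠ 0) (hi : i ≠ 0) :
    HasDerivAt (fun s => gMat p w t (Function.update α k s) i 0)
      (p i t * deriv (p k) t) (α k) := by
  simp only [gMat_ne_zero _ _ hi]
  exact ((hasDerivAt_eqA_update k hk t α).const_mul (-(p i t))).congr_deriv (by ring)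

theorem hasDerivAt_gMat_update_ne_ne {k i j : Fin L} (hi : i ≠ 0) (hj : j ≠ 0) :
    HasDerivAt (fun s => gMat p w t (Function.update α k s) i j) 0 (α k) := by
  simp only [gMat_ne_ne _ _ hi hj]
  exact hasDerivAt_const _ _

theorem differentiableAt_gMat (hp : ∀ i, ContDiff ℝ (⊤ : ℕ∞) (p i))
    (hw : ContDiff ℝ (⊤ : ℕ∞) w) (i j : Fin L) :
    DifferentiableAt ℝ (fun s => gMat p w s α i j) t := by
  by_cases hi : i = 0 <;> by_cases hj : j = 0
  · subst hi hj; exact (hasDerivAt_gMat_zero_zero t α hp hw).differentiableAt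
  · subst hi; simp only [gMat_comm _ _ 0 j]
    exact (hasDerivAt_gMat_ne_zero t α hp hw hj).differentiableAt
  · subst hj; exact (hasDerivAt_gMat_ne_zero t α hp hw hi).differentiableAt
  · exact (hasDerivAt_gMat_ne_ne t α hp hi hj).differentiableAt

theorem differentiableAt_gMat_update {k : Fin L} (hk : k ≠ 0) (i j : Fin L) :
    DifferentiableAt ℝ (fun s => gMat p w t (Function.update α k s) i j) (α k) := by
  by_cases hi : i = 0 <;> by_cases hj : j = 0
  · subst hi hj; exact (hasDerivAt_gMat_update_zero_zero t α hk).differentiableAt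
  · subst hi; simp only [gMat_comm _ _ 0 j]
    exact (hasDerivAt_gMat_update_ne_zero t α hk hj).differentiableAt
  · subst hj; exact (hasDerivAt_gMat_update_ne_zero t α hk hi).differentiableAt
  · exact (hasDerivAt_gMat_update_ne_ne t α hi hj).differentiableAt

end PartialDerivatives

/-- Christoffel symbols of the first kind, `[ij,h]`. -/
def christoffelFirst (p : Fin L → ℝ → ℝ) (w : ℝ → ℝ) (i j h : Fin L)
    (t : ℝ) (α : Fin L → ℝ) : ℝ :=
  (1 / 2) * (pder i (fun t' α' => gMat p w t' α' j h) t α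
    + pder j (fun t' α' => gMat p w t' α' h i) t α
    - pder h (fun t' α' => gMat p w t' α' i j) t α)

theorem christoffel_eq_sum (i j k : Fin L) (t : ℝ) (α : Fin L → ℝ) :
    christoffel p w i j k t α
      = ∑ h, christoffelFirst p w i j h t α * (gMat p w t α)⁻¹ h k := by
  rw [christoffel, Finset.mul_sum]
  refine Finset.sum_congr rfl fun h _ => ?_
  rw [christoffelFirst]; ring

theorem sum_christoffel_mul_gMat {t : ℝ} {α : Fin L → ℝ} (hD : eqD p w t α ≠ 0)
    (i j l : Fin L) :
    ∑ s, christoffel p w i j s t α * gMat p w t α s l = christoffelFirst p w i j l t α := by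
  have h : (fun s => christoffel p w i j s t α)
      = (fun h => christoffelFirst p w i j h t α) ᵥ* (gMat p w t α)⁻¹ := by
    ext s
    exact christoffel_eq_sum i j s t α
  change ((fun s => christoffel p w i j s t α) ᵥ* gMat p w t α) l = _
  rw [h, Matrix.vecMul_vecMul, Matrix.nonsing_inv_mul _ (isUnit_det_gMat hD), Matrix.vecMul_one]

section Symbols

variable (t : ℝ) (α : Fin L → ℝ)

theorem christoffelFirst_zero_zero_zero (hp : ∀ i, ContDiff ℝ (⊤ : ℕ∞) (p i))
    (hw : ContDiff ℝ (⊤ : ℕ∞) w) :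
    christoffelFirst p w 0 0 0 t α = eqC p t + eqA p w t α * eqA' p w t α := by
  simp only [christoffelFirst, pder_zero, (hasDerivAt_gMat_zero_zero t α hp hw).deriv]
  ring

theorem christoffelFirst_zero_zero_ne (hp : ∀ i, ContDiff ℝ (⊤ : ℕ∞) (p i))
    (hw : ContDiff ℝ (⊤ : ℕ∞) w) {h : Fin L} (hh : h ≠ 0) :
    christoffelFirst p w 0 0 h t α = -(p h t) * eqA' p w t α := by
  simp only [christoffelFirst, pder_zero, pder_ne _ _ hh, gMat_comm _ _ 0 h,
    (hasDerivAt_gMat_ne_zero t α hp hw hh).deriv,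
    (hasDerivAt_gMat_update_zero_zero t α hh).deriv]
  ring

theorem christoffelFirst_ne_zero_zero {i : Fin L} (hi : i ≠ 0) :
    christoffelFirst p w i 0 0 t α = -(deriv (p i) t) * eqA p w t α := by
  simp only [christoffelFirst, pder_zero, pder_ne _ _ hi, gMat_comm _ _ 0 i,
    (hasDerivAt_gMat_update_zero_zero t α hi).deriv]
  ring

theorem christoffelFirst_ne_zero_ne (hp : ∀ i, ContDiff ℝ (⊤ : ℕ∞) (p i))
    {i h : Fin L} (hi : i ≠ 0) (hh : h ≠ 0) :
    christoffelFirst p w i 0 h t α = deriv (p i) t * p h t := by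
  simp only [christoffelFirst, pder_zero, pder_ne _ _ hi, pder_ne _ _ hh, gMat_comm _ _ 0 h,
    (hasDerivAt_gMat_update_ne_zero t α hh hi).deriv,
    (hasDerivAt_gMat_update_ne_zero t α hi hh).deriv,
    (hasDerivAt_gMat_ne_ne t α hp hh hi).deriv]
  ring

theorem christoffelFirst_ne_self {i : Fin L} (hp : ∀ i, ContDiff ℝ (⊤ : ℕ∞) (p i))
    (hi : i ≠ 0) (m : Fin L) :
    christoffelFirst p w i m i t α = pder i (fun t' α' => gMat p w t' α' m i) t α := by
  by_cases hm : m = 0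
  · subst hm
    rw [christoffelFirst_ne_zero_ne t α hp hi hi, pder_ne _ _ hi]
    simp only [gMat_comm _ _ 0 i, (hasDerivAt_gMat_update_ne_zero t α hi hi).deriv]
    ring
  · simp only [christoffelFirst, pder_ne _ _ hi, pder_ne _ _ hm,
      (hasDerivAt_gMat_update_ne_ne t α hi hm).deriv,
      (hasDerivAt_gMat_update_ne_ne t α hm hi).deriv,
      (hasDerivAt_gMat_update_ne_ne t α hi hi).deriv]
    ring

theorem pder_zero_gMat_eq_add (i m : Fin L) :
    pder 0 (fun t' α' => gMat p w t' α' m i) t α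
      = christoffelFirst p w 0 m i t α + christoffelFirst p w i 0 m t α := by
  simp only [christoffelFirst, gMat_comm _ _ 0 m, gMat_comm _ _ i 0]
  ring

variable {t α}

theorem christoffel_ne_zero_zero (hp : ∀ i, ContDiff ℝ (⊤ : ℕ∞) (p i))
    (hD : eqD p w t α ≠ 0) {i : Fin L} (hi : i ≠ 0) :
    christoffel p w i 0 0 t α = -(deriv (p i) t) * eqA p w t α / eqD p w t α := by
  rw [christoffel_eq_sum, inv_gMat hD, sum_eq_zero_add_sum_ne,
    sum_ne_congr (g := fun h => (deriv (p i) t * eqA p w t α / eqD p w t α) * (p h t * p h t))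
      fun h hh => by
        rw [christoffelFirst_ne_zero_ne t α hp hi hh, Matrix.smul_apply, invNumer_ne_zero t α hh,
          smul_eq_mul]
        ring,
    ← Finset.mul_sum, sum_sq_eq_eqN_sub_one, christoffelFirst_ne_zero_zero t α hi,
    Matrix.smul_apply, invNumer_zero_zero, smul_eq_mul]
  ring

theorem christoffel_ne_zero_ne (hp : ∀ i, ContDiff ℝ (⊤ : ℕ∞) (p i))
    (hD : eqD p w t α ≠ 0) {i s : Fin L} (hi : i ≠ 0) (hs : s ≠ 0) :
    christoffel p w i 0 s t α = deriv (p i) t * p s t * eqB p t / eqD p w t α := by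
  rw [christoffel_eq_sum, inv_gMat hD, sum_eq_zero_add_sum_ne,
    sum_ne_congr (g := fun h => (-(deriv (p i) t * p s t * eqB p t / eqD p w t α))
        * (p h t * p h t) + if h = s then deriv (p i) t * p s t else 0)
      fun h hh => by
        rw [christoffelFirst_ne_zero_ne t α hp hi hh, Matrix.smul_apply,
          invNumer_ne_ne t α hh hs, smul_eq_mul]
        by_cases e : h = s
        · subst e; simp only [if_true]; field_simp; ring
        · simp only [e, if_false]; ring,
    Finset.sum_add_distrib, ← Finset.mul_sum, sum_sq_eq_eqN_sub_one,
    christoffelFirst_ne_zero_zero t α hi, Matrix.smul_apply, invNumer_zero_ne t α hs, smul_eq_mul]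
  simp only [Finset.sum_ite_eq', Finset.mem_sdiff, Finset.mem_univ, Finset.mem_singleton, hs,
    not_false_eq_true, and_self, if_true]
  field_simp
  rw [eqD]; ring

theorem sum_christoffel_ne_zero_mul_christoffelFirst (hp : ∀ i, ContDiff ℝ (⊤ : ℕ∞) (p i))
    (hD : eqD p w t α ≠ 0) {i : Fin L} (hi : i ≠ 0) :
    ∑ m, christoffel p w i 0 m t α * christoffelFirst p w i 0 m t α
      = deriv (p i) t ^ 2 * (1 - eqB p t / eqD p w t α) := by
  rw [sum_eq_zero_add_sum_ne,
    sum_ne_congr (g := fun h => (deriv (p i) t ^ 2 * eqB p t / eqD p w t α) * (p h t * p h t))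
      fun h hh => by
        rw [christoffelFirst_ne_zero_ne t α hp hi hh, christoffel_ne_zero_ne hp hD hi hh]
        ring,
    ← Finset.mul_sum, sum_sq_eq_eqN_sub_one, christoffelFirst_ne_zero_zero t α hi,
    christoffel_ne_zero_zero hp hD hi]
  field_simp
  rw [eqD]; ring

end Symbols

theorem differentiableAt_eqD (hp : ∀ i, ContDiff ℝ (⊤ : ℕ∞) (p i))
    (hw : ContDiff ℝ (⊤ : ℕ∞) w) (t : ℝ) (α : Fin L → ℝ) :
    DifferentiableAt ℝ (fun x => eqD p w x α) t :=
  ((differentiableAt_eqN hp t).mul (hasDerivAt_eqB hp t).differentiableAt).add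
    ((hasDerivAt_eqA hp hw t α).differentiableAt.pow 2)

theorem differentiableAt_christoffel_ne_zero (hp : ∀ i, ContDiff ℝ (⊤ : ℕ∞) (p i))
    (hw : ContDiff ℝ (⊤ : ℕ∞) w) (hD : ∀ t α, eqD p w t α ≠ 0) (t : ℝ) (α : Fin L → ℝ)
    {i : Fin L} (hi : i ≠ 0) (s : Fin L) :
    DifferentiableAt ℝ (fun x => christoffel p w i 0 s x α) t := by
  have hd := (hasDerivAt_deriv_of_smooth (hp i) t).differentiableAt
  by_cases hs : s = 0
  · subst hs
    simp only [christoffel_ne_zero_zero hp (hD _ _) hi]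
    exact (hd.neg.mul (hasDerivAt_eqA hp hw t α).differentiableAt).div
      (differentiableAt_eqD hp hw t α) (hD _ _)
  · simp only [christoffel_ne_zero_ne hp (hD _ _) hi hs]
    exact ((hd.mul (hasDerivAt_of_smooth (hp s) t).differentiableAt).mul
      (hasDerivAt_eqB hp t).differentiableAt).div (differentiableAt_eqD hp hw t α) (hD _ _)

theorem differentiableAt_christoffelFirst_update (hp : ∀ i, ContDiff ℝ (⊤ : ℕ∞) (p i))
    (hw : ContDiff ℝ (⊤ : ℕ∞) w) (t : ℝ) (α : Fin L → ℝ) {k : Fin L} (hk : k ≠ 0)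
    (h : Fin L) :
    DifferentiableAt ℝ
      (fun x => christoffelFirst p w 0 0 h t (Function.update α k x)) (α k) := by
  have hA := (hasDerivAt_eqA_update (p := p) (w := w) k hk t α).differentiableAt
  have hA' := (hasDerivAt_eqA'_update (p := p) (w := w) k hk t α).differentiableAt
  by_cases hh : h = 0
  · subst hh
    simp only [christoffelFirst_zero_zero_zero _ _ hp hw]
    exact (hA.mul hA').const_add _
  · simp only [christoffelFirst_zero_zero_ne _ _ hp hw hh]
    exact hA'.const_mul _

theorem differentiableAt_eqD_update (t : ℝ) (α : Fin L → ℝ) {k : Fin L} (hk : k ≠ 0) :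
    DifferentiableAt ℝ (fun x => eqD p w t (Function.update α k x)) (α k) :=
  ((hasDerivAt_eqA_update (p := p) (w := w) k hk t α).differentiableAt.pow 2).const_add _

theorem differentiableAt_invNumer_update (t : ℝ) (α : Fin L → ℝ) {k : Fin L} (hk : k ≠ 0)
    (i j : Fin L) :
    DifferentiableAt ℝ (fun x => invNumer p w t (Function.update α k x) i j) (α k) := by
  have hA := (hasDerivAt_eqA_update (p := p) (w := w) k hk t α).differentiableAt
  have hDd := differentiableAt_eqD_update (p := p) (w := w) t α hk
  by_cases hi : i = 0 <;> by_cases hj : j = 0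
  · subst hi hj; simp only [invNumer_zero_zero]; exact differentiableAt_const _
  · subst hi; simp only [invNumer_zero_ne _ _ hj]; exact hA.const_mul _
  · subst hj; simp only [invNumer_ne_zero _ _ hi]; exact hA.const_mul _
  · simp only [invNumer_ne_ne _ _ hi hj]
    split_ifs
    · exact hDd.sub_const _
    · exact differentiableAt_const _

theorem differentiableAt_christoffel_update (hp : ∀ i, ContDiff ℝ (⊤ : ℕ∞) (p i))
    (hw : ContDiff ℝ (⊤ : ℕ∞) w) (hD : ∀ t α, eqD p w t α ≠ 0) (t : ℝ) (α : Fin L → ℝ)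
    {k : Fin L} (hk : k ≠ 0) (s : Fin L) :
    DifferentiableAt ℝ (fun x => christoffel p w 0 0 s t (Function.update α k x)) (α k) := by
  simp only [christoffel_eq_sum, inv_gMat (hD _ _), Matrix.smul_apply, smul_eq_mul]
  exact DifferentiableAt.fun_sum fun h _ =>
    (differentiableAt_christoffelFirst_update hp hw t α hk h).mul
      (((differentiableAt_eqD_update t α hk).inv (by simpa using hD _ _)).mul
        (differentiableAt_invNumer_update t α hk h s))

theorem sum_pder_christoffel_zero_zero_mul_gMat (hp : ∀ i, ContDiff ℝ (⊤ : ℕ∞) (p i))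
    (hw : ContDiff ℝ (⊤ : ℕ∞) w) (hD : ∀ t α, eqD p w t α ≠ 0) (t : ℝ) (α : Fin L → ℝ)
    {i : Fin L} (hi : i ≠ 0) :
    ∑ s, pder i (christoffel p w 0 0 s) t α * gMat p w t α s i
      = p i t * deriv (deriv (p i)) t - ∑ s, christoffel p w 0 0 s t α
          * pder i (fun t' α' => gMat p w t' α' s i) t α := by
  have h := deriv_sum_mul (x := α i)
    (F := fun s x => christoffel p w 0 0 s t (Function.update α i x))
    (G := fun s x => gMat p w t (Function.update α i x) s i)
    (differentiableAt_christoffel_update hp hw hD t α hi)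
    (fun s => differentiableAt_gMat_update t α hi s i)
  simp only [sum_christoffel_mul_gMat (hD _ _), christoffelFirst_zero_zero_ne _ _ hp hw hi,
    ((hasDerivAt_eqA'_update (p := p) (w := w) i hi t α).const_mul (-(p i t))).deriv,
    Function.update_eq_self] at h
  simp only [pder_ne _ _ hi]
  linarith

theorem sum_pder_christoffel_ne_zero_mul_gMat (hp : ∀ i, ContDiff ℝ (⊤ : ℕ∞) (p i))
    (hw : ContDiff ℝ (⊤ : ℕ∞) w) (hD : ∀ t α, eqD p w t α ≠ 0) (t : ℝ) (α : Fin L → ℝ)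
    {i : Fin L} (hi : i ≠ 0) :
    ∑ s, pder 0 (christoffel p w i 0 s) t α * gMat p w t α s i
      = deriv (deriv (p i)) t * p i t + deriv (p i) t * deriv (p i) t
        - ∑ s, christoffel p w i 0 s t α * pder 0 (fun t' α' => gMat p w t' α' s i) t α := by
  have h := deriv_sum_mul (x := t)
    (F := fun s x => christoffel p w i 0 s x α) (G := fun s x => gMat p w x α s i)
    (differentiableAt_christoffel_ne_zero hp hw hD t α hi)
    (fun s => differentiableAt_gMat t α hp hw s i)
  have h' := ((hasDerivAt_deriv_of_smooth (hp i) t).fun_mul (hasDerivAt_of_smooth (hp i) t)).deriv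
  simp only [sum_christoffel_mul_gMat (hD _ _), christoffelFirst_ne_zero_ne _ _ hp hi hi, h'] at h
  simp only [pder_zero]
  linarith

/-- The lowered curvature coefficient `R_{0i0i}`, in closed form. -/
theorem sum_curvR_mul_gMat (hp : ∀ i, ContDiff ℝ (⊤ : ℕ∞) (p i))
    (hw : ContDiff ℝ (⊤ : ℕ∞) w) (hD : ∀ t α, eqD p w t α ≠ 0) (t : ℝ) (α : Fin L → ℝ)
    {i : Fin L} (hi : i ≠ 0) :
    ∑ s, curvR p w 0 i 0 s t α * gMat p w t α s i
      = -(deriv (p i) t ^ 2 * eqB p t / eqD p w t α) := by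
  have contract : ∀ a b : Fin L, ∑ s, (∑ m, christoffel p w a 0 m t α
      * christoffel p w b m s t α) * gMat p w t α s i
      = ∑ m, christoffel p w a 0 m t α * christoffelFirst p w b m i t α := by
    intro a b
    simp only [Finset.sum_mul, ← sum_christoffel_mul_gMat (hD t α), Finset.mul_sum, mul_assoc]
    exact Finset.sum_comm
  have split : ∑ m, christoffel p w i 0 m t α * pder 0 (fun t' α' => gMat p w t' α' m i) t α
      = ∑ m, christoffel p w i 0 m t α * christoffelFirst p w 0 m i t α
        + ∑ m, christoffel p w i 0 m t α * christoffelFirst p w i 0 m t α := by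
    rw [← Finset.sum_add_distrib]
    exact Finset.sum_congr rfl fun m _ => by rw [pder_zero_gMat_eq_add, mul_add]
  simp only [curvR, sub_mul, add_mul, Finset.sum_sub_distrib, Finset.sum_add_distrib]
  rw [contract, contract, sum_pder_christoffel_zero_zero_mul_gMat hp hw hD t α hi,
    sum_pder_christoffel_ne_zero_mul_gMat hp hw hD t α hi, split,
    sum_christoffel_ne_zero_mul_christoffelFirst hp (hD t α) hi]
  simp only [christoffelFirst_ne_self t α hp hi]
  ring

end Curvature

theorem statement_17 (L : ℕ) [NeZero L] (hL : 2 ≤ L)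
    (p : Fin L → ℝ → ℝ) (w : ℝ → ℝ)
    (hp : ∀ i, ContDiff ℝ (⊤ : ℕ∞) (p i)) (hw : ContDiff ℝ (⊤ : ℕ∞) w)
    (hreg : ∀ t : ℝ, 0 < eqB p t ∨ deriv w t ≠ 0) :
    ((∀ i : Fin L, i ≠ 0 →
        ∀ (t : ℝ) (α : Fin L → ℝ),
          ∑ s : Fin L, curvR p w 0 i 0 s t α * gMat p w t α s i = 0)
      ↔ (∀ t : ℝ, ∀ i : Fin L, i ≠ 0 → deriv (p i) t = 0))
    ∧ ((∀ t : ℝ, ∀ i : Fin L, i ≠ 0 → deriv (p i) t = 0)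
      ↔ (∀ i : Fin L, i ≠ 0 → ∀ t t' : ℝ, p i t = p i t')) := by
  have hD : ∀ t α, eqD p w t α ≠ 0 := fun t α => (eqD_pos hreg t α).ne'
  refine ⟨⟨fun h t i hi => ?_, fun h i hi t α => ?_⟩, fun h i hi => ?_, fun h t i hi => ?_⟩
  · have h0 := h i hi t 0
    rw [sum_curvR_mul_gMat hp hw hD t 0 hi, neg_eq_zero, div_eq_zero_iff,
      or_iff_left (hD t 0), mul_eq_zero] at h0
    exact h0.elim (fun h1 => pow_eq_zero_iff two_ne_zero |>.1 h1)
      fun h1 => deriv_eq_zero_of_eqB_eq_zero h1 hi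
  · rw [sum_curvR_mul_gMat hp hw hD t α hi, h t i hi]
    simp
  · exact is_const_of_deriv_eq_zero ((hp i).differentiable (by simp)) fun t => h t i hi
  · rw [show p i = fun _ => p i 0 from funext fun x => h i hi x 0, deriv_const]

end EqSelection
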